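/- arXiv:1511.03737 — 2 statements merged into one kernel-verified Lean document; each statement's English description precedes it below -/
import Mathlib

section
/- Let f : L → K be a {0,1}-lattice homomorphism between finite distributive lattices and let φ = J(f) be its Birkhoff dual. Then for every join-irreducible j ∈ J(L): j lies in the image of φ if and only if j ∉ N(f). -/
open Function

/-- An element of a lattice with least element `⊥` is join-irreducible if it is not `⊥`
and `j = a ⊔ b` implies `j = a` or `j = b`. -/
def JoinIrred {L : Type*} [Lattice L] [OrderBot L] (j : L) : Prop :=
  j ≠ ⊥ ∧ ∀ a b : L, j = a ⊔ b → j = a ∨ j = b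

/-- `latN f` is the set `N(f) = {x | ∃ y, y < x ∧ f y = f x}`. -/
def latN {L K : Type*} [Preorder L] (f : L → K) : Set L :=
  {x | ∃ y, y < x ∧ f y = f x}

open Classical in
/-- `minus x S` is `x − S`: the join of the set of join-irreducibles `j` with
`j ≤ x` and `j ∉ S` (the empty join being `⊥`). -/
noncomputable def minus {L : Type*} [Lattice L] [OrderBot L] [Fintype L]
    (x : L) (S : Set L) : L :=
  (Finset.univ.filter fun j : L => JoinIrred j ∧ j ≤ x ∧ j ∉ S).sup id

/-- A `{0,1}`-lattice homomorphism: a map preserving `⊔`, `⊓`, `⊥` and `⊤`. -/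
def IsBddLatticeHom {L K : Type*} [Lattice L] [BoundedOrder L] [Lattice K] [BoundedOrder K]
    (f : L → K) : Prop :=
  (∀ x y : L, f (x ⊔ y) = f x ⊔ f y) ∧ (∀ x y : L, f (x ⊓ y) = f x ⊓ f y) ∧
    f ⊥ = ⊥ ∧ f ⊤ = ⊤

/-- `r` is a natural linear order on the bounded lattice `L`: it is a (reflexive) linear
order whose restriction to the join-irreducibles extends the lattice order, and which is
the antilexicographic order determined by this restriction: for distinct `x`, `y`,
`x` is strictly below `y` iff the `r`-greatest join-irreducible `j` for which exactly one
of `j ≤ x`, `j ≤ y` holds satisfies `j ≤ y`. -/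
def IsNaturalOrder {L : Type*} [Lattice L] [BoundedOrder L] (r : L → L → Prop) : Prop :=
  IsLinearOrder L r ∧
  (∀ j j' : L, JoinIrred j → JoinIrred j' → j ≤ j' → r j j') ∧
  ∀ x y : L, x ≠ y →
    (r x y ↔ ∃ j : L, JoinIrred j ∧ j ≤ y ∧ ¬ j ≤ x ∧
      ∀ j' : L, JoinIrred j' → ¬ ((j' ≤ x) ↔ (j' ≤ y)) → r j' j)

/-- A homomorphism `f : L → K` between lattices carrying linear orders `rL`, `rK`
is positive if `x − N(f) ⊑ y − N(f)` implies `f x ≼ f y`. -/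
def IsPositive {L K : Type*} [Lattice L] [OrderBot L] [Fintype L]
    (rL : L → L → Prop) (rK : K → K → Prop) (f : L → K) : Prop :=
  ∀ x y : L, rL (minus x (latN f)) (minus y (latN f)) → rK (f x) (f y)

open Classical in
/-- The Birkhoff dual of a `{0,1}`-lattice homomorphism: `J(f)(y) = ⋀ {x | f x ≥ y}`. -/
noncomputable def birkhoffDual {L K : Type*} [Lattice L] [OrderTop L] [Fintype L] [Preorder K]
    (f : L → K) (y : K) : L :=
  (Finset.univ.filter fun x : L => y ≤ f x).inf id

/-- The Birkhoff dual is the lower adjoint of `f`. -/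
theorem birkhoffDual_le_iff {L K : Type*} [Lattice L] [Fintype L] [BoundedOrder L]
    [Lattice K] [BoundedOrder K] {f : L → K} (hf : IsBddLatticeHom f) (y : K) (x : L) :
    birkhoffDual f y ≤ x ↔ y ≤ f x := by
  classical
  obtain ⟨-, hinf, -, htop⟩ := hf
  have hmono : Monotone f := fun a b hab => by
    rw [← inf_eq_left.mpr hab, hinf]
    exact inf_le_right
  constructor
  · intro h
    refine le_trans ?_ (hmono h)
    unfold birkhoffDual
    refine Finset.inf_induction (p := fun z => y ≤ f z) ?_ ?_ ?_
    · rw [htop]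
      exact le_top
    · intro a ha b hb
      rw [hinf]
      exact le_inf ha hb
    · intro b hb
      simpa using hb
  · intro h
    exact Finset.inf_le (f := id) (by simpa using h)

/-- In a finite lattice, a join-irreducible element has a greatest element strictly below it. -/
theorem JoinIrred.exists_isGreatest_Iio {L : Type*} [Lattice L] [OrderBot L] [Fintype L]
    {j : L} (hj : JoinIrred j) : ∃ m, IsGreatest (Set.Iio j) m := by
  classical
  refine ⟨(Finset.univ.filter fun x : L => x < j).sup id, ?_, ?_⟩
  · refine Finset.sup_induction (p := fun z => z < j) (bot_lt_iff_ne_bot.mpr hj.1) ?_ ?_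
    · intro a ha b hb
      refine lt_of_le_of_ne (sup_le ha.le hb.le) fun h => ?_
      rcases hj.2 a b h.symm with h | h
      · exact ha.ne h.symm
      · exact hb.ne h.symm
    · intro b hb
      simpa using hb
  · intro x hx
    exact Finset.le_sup (f := id) (by simpa using hx)

/-- In a finite lattice, join-irreducible elements separate `a` from any `b` with `¬ a ≤ b`. -/
theorem exists_joinIrred_le_not_le {K : Type*} [Lattice K] [OrderBot K] [Finite K]
    {a b : K} (hab : ¬ a ≤ b) : ∃ y, JoinIrred y ∧ y ≤ a ∧ ¬ y ≤ b := by
  obtain ⟨y, ⟨hya, hyb⟩, hmin⟩ :=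
    (Set.toFinite {y : K | y ≤ a ∧ ¬ y ≤ b}).exists_minimal ⟨a, le_rfl, hab⟩
  refine ⟨y, ⟨fun h => hyb (h ▸ bot_le), fun c d hcd => ?_⟩, hya, hyb⟩
  by_contra! hne
  have key : ∀ z, z ≤ y → y ≠ z → z ≤ b := fun z hz hzy => by
    by_contra hzb
    exact hzy (le_antisymm (hmin ⟨hz.trans hya, hzb⟩ hz) hz)
  apply hyb
  rw [hcd]
  exact sup_le (key c (hcd ▸ le_sup_left) hne.1) (key d (hcd ▸ le_sup_right) hne.2)

/-- for a `{0,1}`-lattice homomorphism `f : L → K` with Birkhoff dual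
`φ = J(f)`, a join-irreducible `j ∈ J(L)` lies in the image of `φ` iff `j ∉ N(f)`. -/
theorem birkhoffDual_image_iff_not_mem_N {L K : Type*}
    [DistribLattice L] [Fintype L] [BoundedOrder L]
    [DistribLattice K] [Fintype K] [BoundedOrder K]
    (f : L → K) (hf : IsBddLatticeHom f) (j : L) (hj : JoinIrred j) :
    (∃ y : K, JoinIrred y ∧ birkhoffDual f y = j) ↔ j ∉ latN f := by
  constructor
  · rintro ⟨y, -, rfl⟩ ⟨z, hz, hfz⟩
    refine hz.not_ge ((birkhoffDual_le_iff hf y z).mpr ?_)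
    rw [hfz]
    exact (birkhoffDual_le_iff hf y _).mp le_rfl
  · intro hjN
    obtain ⟨m, hm, hmax⟩ := hj.exists_isGreatest_Iio
    have hle : ¬ f j ≤ f m := fun h => by
      refine hjN ⟨m, hm, le_antisymm ?_ h⟩
      rw [← inf_eq_left.mpr (le_of_lt hm), hf.2.1]
      exact inf_le_right
    obtain ⟨y, hy, hyj, hym⟩ := exists_joinIrred_le_not_le hle
    refine ⟨y, hy, ?_⟩
    by_contra hne
    have hlt := lt_of_le_of_ne ((birkhoffDual_le_iff hf y j).mpr hyj) hne
    exact hym ((birkhoffDual_le_iff hf y m).mp (hmax hlt))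
end

section
/- Let L_⊑ be a naturally ordered finite distributive lattice and let f : L → K be a surjective {0,1}-lattice homomorphism onto a finite distributive lattice K whose kernel is positive, i.e. for all a, b ∈ L with f(a) ≠ f(b), either c − N(f) ⊑ d − N(f) for all c, d ∈ L with f(c) = f(a) and f(d) = f(b), or d − N(f) ⊑ c − N(f) for all such c, d. Define a relation ≼ on K by: u ≼ v iff u = v, or u ≠ v and a − N(f) ⊑ b − N(f) for all a, b ∈ L with f(a) = u and f(b) = v. Then ≼ is a natural linear order on K (in particular it is a linear order extending the lattice order of K). -/
open Function

/-- The kernel of `f` is a positive congruence: any two distinct kernel classes are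
uniformly comparable via `· − N(f)` in the order `rL`. -/
def KernelPositive {L K : Type*} [Lattice L] [OrderBot L] [Fintype L]
    (rL : L → L → Prop) (f : L → K) : Prop :=
  ∀ a b : L, f a ≠ f b →
    (∀ c d : L, f c = f a → f d = f b → rL (minus c (latN f)) (minus d (latN f))) ∨
    (∀ c d : L, f c = f a → f d = f b → rL (minus d (latN f)) (minus c (latN f)))

/-- The order induced on `K` by a kernel-positive surjection `f : L → K`:
`u ≼ v` iff `u = v`, or `u ≠ v` and `a − N(f) ⊑ b − N(f)` for all `a, b` with
`f a = u` and `f b = v`. -/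
def quotOrder {L K : Type*} [Lattice L] [OrderBot L] [Fintype L]
    (rL : L → L → Prop) (f : L → K) : K → K → Prop :=
  fun u v => u = v ∨ (u ≠ v ∧
    ∀ a b : L, f a = u → f b = v → rL (minus a (latN f)) (minus b (latN f)))

theorem joinIrred_iff_supIrred {L : Type*} [Lattice L] [OrderBot L] (j : L) :
    JoinIrred j ↔ SupIrred j := by
  simp only [JoinIrred, SupIrred, isMin_iff_eq_bot, ne_eq, eq_comm]

theorem IsNaturalOrder.of_le {L : Type*} [Lattice L] [BoundedOrder L] {r : L → L → Prop}
    (h : IsNaturalOrder r) {x y : L} (hxy : x ≤ y) : r x y := by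
  have := h.1
  rcases eq_or_ne y x with rfl | hne
  · exact refl_of r _
  · refine (total_of r x y).resolve_right fun hyx => ?_
    obtain ⟨j, -, hjx, hjy, -⟩ := (h.2.2 y x hne).1 hyx
    exact hjy (hjx.trans hxy)

theorem IsBddLatticeHom.monotone {L K : Type*} [Lattice L] [BoundedOrder L] [Lattice K]
    [BoundedOrder K] {f : L → K} (hf : IsBddLatticeHom f) : Monotone f := fun x y h => by
  rw [← sup_eq_right, ← hf.1, sup_eq_right.2 h]

section BirkhoffDual

variable {L K : Type*} [DistribLattice L] [Fintype L] [BoundedOrder L]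
  [DistribLattice K] [BoundedOrder K] {f : L → K}

theorem gc_birkhoffDual (hf : IsBddLatticeHom f) : GaloisConnection (birkhoffDual f) f := by
  classical
  intro u x
  refine ⟨fun h => le_trans ?_ (hf.monotone h), fun h => Finset.inf_le (f := id) (by simpa using h)⟩
  unfold birkhoffDual
  refine Finset.inf_induction (p := fun x => u ≤ f x) ?_ ?_ ?_
  · simp [hf.2.2.2]
  · intro a ha b hb
    rw [hf.2.1]
    exact le_inf ha hb
  · intro b hb
    simpa using hb

theorem apply_birkhoffDual (hf : IsBddLatticeHom f) (hsurj : Surjective f) (u : K) :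
    f (birkhoffDual f u) = u := by
  obtain ⟨x, rfl⟩ := hsurj u
  exact (gc_birkhoffDual hf).u_l_u_eq_u x

theorem birkhoffDual_le_iff_s9 (hf : IsBddLatticeHom f) (hsurj : Surjective f) {u v : K} :
    birkhoffDual f u ≤ birkhoffDual f v ↔ u ≤ v := by
  rw [gc_birkhoffDual hf u, apply_birkhoffDual hf hsurj]

theorem joinIrred_birkhoffDual (hf : IsBddLatticeHom f) (hsurj : Surjective f) {k : K}
    (hk : JoinIrred k) : JoinIrred (birkhoffDual f k) := by
  have happ := apply_birkhoffDual hf hsurj k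
  refine ⟨fun h => hk.1 ?_, fun a b hab => ?_⟩
  · rw [← happ, h, hf.2.2.1]
  · have hle : ∀ x, k = f x → birkhoffDual f k ≤ x := fun x hx =>
      (gc_birkhoffDual hf _ _).2 hx.le
    refine (hk.2 (f a) (f b) (by rw [← hf.1, ← hab, happ])).imp (fun h => ?_) (fun h => ?_)
    · exact (hle a h).antisymm (hab ▸ le_sup_left)
    · exact (hle b h).antisymm (hab ▸ le_sup_right)

theorem minus_latN_eq_birkhoffDual [Finite K] (hf : IsBddLatticeHom f) (hsurj : Surjective f)
    (a : L) : minus a (latN f) = birkhoffDual f (f a) := by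
  classical
  have gc := gc_birkhoffDual hf
  apply le_antisymm
  · refine Finset.sup_le fun j hj => ?_
    obtain ⟨-, -, hja, hjN⟩ := Finset.mem_filter.1 hj
    have hj' : birkhoffDual f (f j) = j := by
      by_contra hne
      exact hjN ⟨_, lt_of_le_of_ne (gc.l_u_le j) hne, apply_birkhoffDual hf hsurj _⟩
    rw [id, ← hj']
    exact gc.monotone_l (hf.monotone hja)
  · obtain ⟨s, hs, hirr⟩ := exists_supIrred_decomposition (f a)
    rw [gc _ _]
    conv_lhs => rw [← hs]
    refine Finset.sup_le fun k hk => (gc _ _).1 ?_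
    refine Finset.le_sup (f := id) (Finset.mem_filter.2 ⟨Finset.mem_univ _, ?_, ?_, ?_⟩)
    · exact joinIrred_birkhoffDual hf hsurj ((joinIrred_iff_supIrred k).2 (hirr hk))
    · exact (gc _ _).2 (hs ▸ Finset.le_sup (f := id) hk)
    · rintro ⟨y, hy, hfy⟩
      replace hfy : f y = k := hfy.trans (apply_birkhoffDual hf hsurj k)
      exact hy.not_ge ((gc _ _).2 hfy.ge)

theorem exists_joinIrred_le_birkhoffDual [Finite K] (hf : IsBddLatticeHom f) {j : L}
    (hj : JoinIrred j) {v : K} (hjv : j ≤ birkhoffDual f v) :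
    ∃ k, JoinIrred k ∧ k ≤ v ∧ j ≤ birkhoffDual f k := by
  classical
  obtain ⟨s, rfl, hirr⟩ := exists_supIrred_decomposition v
  have hle : birkhoffDual f (s.sup id) ≤ s.sup (birkhoffDual f) :=
    (gc_birkhoffDual hf _ _).2 <| Finset.sup_le fun k hk =>
      (gc_birkhoffDual hf _ _).1 (Finset.le_sup hk)
  obtain ⟨k, hk, hjk⟩ := (((joinIrred_iff_supIrred j).1 hj).supPrime.le_finset_sup).1
    (hjv.trans hle)
  exact ⟨k, (joinIrred_iff_supIrred k).2 (hirr hk), Finset.le_sup (f := id) hk, hjk⟩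

theorem quotOrder_iff [Finite K] {rL : L → L → Prop} [Std.Refl rL] (hf : IsBddLatticeHom f)
    (hsurj : Surjective f) (u v : K) :
    quotOrder rL f u v ↔ rL (birkhoffDual f u) (birkhoffDual f v) := by
  simp only [quotOrder, minus_latN_eq_birkhoffDual hf hsurj]
  constructor
  · rintro (rfl | ⟨-, h⟩)
    · exact refl_of rL _
    · simpa only [apply_birkhoffDual hf hsurj] using
        h _ _ (apply_birkhoffDual hf hsurj u) (apply_birkhoffDual hf hsurj v)
  · intro h
    refine or_iff_not_imp_left.2 fun hne => ⟨hne, ?_⟩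
    rintro a b rfl rfl
    exact h

/-- For distinct `u`, `v`, if the dual of `u` precedes that of `v`, then the greatest
join-irreducible on which these duals differ is itself the dual of a join-irreducible of `K`. -/
theorem exists_joinIrred_of_birkhoffDual_rel [Finite K] {rL : L → L → Prop}
    (hL : IsNaturalOrder rL) (hf : IsBddLatticeHom f) (hsurj : Surjective f) {u v : K}
    (hne : u ≠ v) (h : rL (birkhoffDual f u) (birkhoffDual f v)) :
    ∃ k : K, JoinIrred k ∧ k ≤ v ∧ ¬ k ≤ u ∧ ∀ k' : K, JoinIrred k' →
      ¬ ((k' ≤ u) ↔ (k' ≤ v)) → rL (birkhoffDual f k') (birkhoffDual f k) := by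
  have hle {u v : K} := birkhoffDual_le_iff_s9 hf hsurj (u := u) (v := v)
  have hne' : birkhoffDual f u ≠ birkhoffDual f v := fun h =>
    hne ((hle.1 h.le).antisymm (hle.1 h.ge))
  obtain ⟨j, hj, hjv, hju, hmax⟩ := (hL.2.2 _ _ hne').1 h
  obtain ⟨k, hk, hkv, hjk⟩ := exists_joinIrred_le_birkhoffDual hf hj hjv
  have hku : ¬ k ≤ u := fun hku => hju (hjk.trans (hle.2 hku))
  have := hL.1
  refine ⟨k, hk, hkv, hku, fun k' hk' hd => ?_⟩
  exact trans_of rL (hmax _ (joinIrred_birkhoffDual hf hsurj hk') (by rwa [hle, hle]))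
    (hL.of_le hjk)

end BirkhoffDual

/-- if `f : L → K` is a surjective `{0,1}`-lattice homomorphism from a
naturally ordered finite distributive lattice whose kernel is positive, then the
induced order `≼` on `K` is a natural linear order extending the lattice order of `K`. -/
theorem quotOrder_natural {L K : Type*}
    [DistribLattice L] [Fintype L] [BoundedOrder L]
    [DistribLattice K] [Fintype K] [BoundedOrder K]
    (rL : L → L → Prop) (hL : IsNaturalOrder rL)
    (f : L → K) (hf : IsBddLatticeHom f) (hsurj : Function.Surjective f)
    (hker : KernelPositive rL f) :
    IsNaturalOrder (quotOrder rL f) ∧ ∀ u v : K, u ≤ v → quotOrder rL f u v := by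
  have := hL.1
  have hq := quotOrder_iff (rL := rL) hf hsurj
  have hle {u v : K} := birkhoffDual_le_iff_s9 hf hsurj (u := u) (v := v)
  have hext : ∀ u v : K, u ≤ v → quotOrder rL f u v := fun u v h =>
    (hq u v).2 (hL.of_le (hle.2 h))
  have hanti : ∀ u v : K, quotOrder rL f u v → quotOrder rL f v u → u = v := by
    intro u v huv hvu
    have h := antisymm_of rL ((hq u v).1 huv) ((hq v u).1 hvu)
    exact (hle.1 h.le).antisymm (hle.1 h.ge)
  have htotal : ∀ u v : K, quotOrder rL f u v ∨ quotOrder rL f v u := by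
    intro u v
    rw [hq, hq]
    exact total_of rL _ _
  have hgreatest : ∀ u v : K, u ≠ v → quotOrder rL f u v →
      ∃ k : K, JoinIrred k ∧ k ≤ v ∧ ¬ k ≤ u ∧
        ∀ k' : K, JoinIrred k' → ¬ ((k' ≤ u) ↔ (k' ≤ v)) → quotOrder rL f k' k := by
    intro u v hne huv
    simp only [hq] at huv ⊢
    exact exists_joinIrred_of_birkhoffDual_rel hL hf hsurj hne huv
  refine ⟨⟨?_, fun j j' _ _ h => hext j j' h, fun u v hne => ⟨hgreatest u v hne, ?_⟩⟩, hext⟩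
  · exact
      { refl := fun u => hext u u le_rfl
        trans := fun u v w huv hvw =>
          (hq u w).2 (trans_of rL ((hq u v).1 huv) ((hq v w).1 hvw))
        antisymm := hanti
        total := htotal }
  · rintro ⟨k, hk, hkv, hku, hmax⟩
    refine (htotal u v).resolve_right fun hvu => ?_
    obtain ⟨k₁, hk₁, hk₁u, hk₁v, hmax₁⟩ := hgreatest v u hne.symm hvu
    have : k = k₁ := hanti _ _ (hmax₁ k hk (by tauto)) (hmax k₁ hk₁ (by tauto))
    exact hku (this ▸ hk₁u)
end
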